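/- arXiv:2404.09501 — 3 statements merged into one kernel-verified Lean document; each statement's English description precedes it below -/
import Mathlib

section
/- Let N ≥ 2, 1 < p < N, p < q < ∞, p* := Np/(N−p), r > max(q, p*), and let a : ℤ^N → [0,∞) be arbitrary. Then lim_{t→+∞} S_t / t = 0 and lim_{t→0⁺} S_t / t = +∞. -/
open Filter Topology
open scoped ENNReal Classical

noncomputable section

abbrev ZN (N : ℕ) := Fin N → ℤ

def adj {N : ℕ} (x y : ZN N) : Prop := (∑ i, (x i - y i).natAbs) = 1

def eInt {N : ℕ} (g : ZN N → ZN N → ℝ) : ℝ≥0∞ :=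
  (∑' e : ZN N × ZN N, if adj e.1 e.2 then ENNReal.ofReal (g e.1 e.2) else 0) / 2

def grad {N : ℕ} (u : ZN N → ℝ) (x y : ZN N) : ℝ := u y - u x

def energy {N : ℕ} (p q : ℝ) (a u : ZN N → ℝ) : ℝ≥0∞ :=
  eInt (fun x y => (1 / p) * |grad u x y| ^ p + (a x / q) * |grad u x y| ^ q)

def gradModular {N : ℕ} (p q : ℝ) (a u : ZN N → ℝ) : ℝ≥0∞ :=
  eInt (fun x y => |grad u x y| ^ p + a x * |grad u x y| ^ q)

def vsum {N : ℕ} (r : ℝ) (u : ZN N → ℝ) : ℝ≥0∞ :=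
  ∑' x : ZN N, ENNReal.ofReal (|u x| ^ r)

def Slevel {N : ℕ} (p q : ℝ) (a : ZN N → ℝ) (r t : ℝ) : ℝ≥0∞ :=
  sInf { c : ℝ≥0∞ | ∃ u : ZN N → ℝ, (Function.support u).Finite ∧
      vsum r u = ENNReal.ofReal (r * t) ∧ energy p q a u = c }

def Lop {N : ℕ} (p q : ℝ) (a u : ZN N → ℝ) (x₀ : ZN N) : ℝ :=
  -(∑' y : ZN N, if adj x₀ y then |u y - u x₀| ^ (p - 2) * (u y - u x₀) else 0)
    - ∑' y : ZN N, if adj x₀ y then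
        ((a x₀ + a y) / 2) * (|u y - u x₀| ^ (q - 2) * (u y - u x₀)) else 0

theorem ofReal_abs_le_tsum_abs_sub {w : ℤ → ℝ} (hw : (Function.support w).Finite) (k : ℤ) :
    ENNReal.ofReal |w k| ≤ ∑' j, ENNReal.ofReal |w (j + 1) - w j| := by
  have hinj : Function.Injective fun n : ℕ => k + (n : ℤ) := fun m n h => by simpa using h
  obtain ⟨n, hn⟩ := (hw.preimage hinj.injOn).exists_notMem
  have hn0 : w (k + n) = 0 := by simpa using hn
  have h := dist_le_range_sum_dist (fun m : ℕ => w (k + m)) n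
  simp only [Real.dist_eq, hn0, Nat.cast_zero, add_zero, sub_zero] at h
  calc ENNReal.ofReal |w k|
      ≤ ENNReal.ofReal (∑ m ∈ Finset.range n, |w (k + m) - w (k + (m + 1 : ℕ))|) :=
        ENNReal.ofReal_le_ofReal h
    _ = ∑ m ∈ Finset.range n, ENNReal.ofReal |w (k + m) - w (k + (m + 1 : ℕ))| :=
        ENNReal.ofReal_sum_of_nonneg fun _ _ => abs_nonneg _
    _ = ∑ m ∈ Finset.range n, ENNReal.ofReal |w (k + m + 1) - w (k + m)| := by
        refine Finset.sum_congr rfl fun m _ => ?_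
        rw [abs_sub_comm, Nat.cast_succ, add_assoc]
    _ ≤ ∑' m : ℕ, ENNReal.ofReal |w (k + m + 1) - w (k + m)| := ENNReal.sum_le_tsum _
    _ ≤ _ := ENNReal.tsum_comp_le_tsum_of_injective hinj
        (fun j => ENNReal.ofReal |w (j + 1) - w j|)

theorem pi_count_eq_count (N : ℕ) :
    MeasureTheory.Measure.pi
      (fun _ : Fin N => (MeasureTheory.Measure.count : MeasureTheory.Measure ℤ)) = MeasureTheory.Measure.count := by
  refine MeasureTheory.Measure.ext_of_singleton fun x => ?_
  rw [MeasureTheory.Measure.pi_singleton]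
  simp

/-- The sum over the lattice of the absolute forward differences, raised to the power `s`. -/
def forwardSum {N : ℕ} (s : ℝ) (u : ZN N → ℝ) : ℝ≥0∞ :=
  ∑' z : ZN N × Fin N, ENNReal.ofReal (|u (z.1 + Pi.single z.2 1) - u z.1| ^ s)

/-- The discrete Gagliardo–Nirenberg inequality, the case `p = 1` of Sobolev's. -/
theorem tsum_rpow_le_forwardSum {N : ℕ} (hN : 2 ≤ N) {v : ZN N → ℝ}
    (hv : (Function.support v).Finite) :
    ∑' x, ENNReal.ofReal |v x| ^ ((N : ℝ) / (N - 1))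
      ≤ forwardSum 1 v ^ ((N : ℝ) / (N - 1)) := by
  have hN' : (2 : ℝ) ≤ N := by exact_mod_cast hN
  set f : ZN N → ℝ≥0∞ := fun x => ∑ i, ENNReal.ofReal |v (x + Pi.single i 1) - v x| with hf
  have hS : forwardSum 1 v = ∑' x, f x := by
    simp only [forwardSum, Real.rpow_one, hf]
    rw [ENNReal.tsum_prod']
    simp only [tsum_fintype]
  have hconj : Real.HolderConjugate (Fintype.card (Fin N)) ((N : ℝ) / (N - 1)) := by
    rw [Fintype.card_fin]
    exact Real.HolderConjugate.conjExponent (by linarith)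
  have key := MeasureTheory.lintegral_prod_lintegral_pow_le
    (fun _ : Fin N => (MeasureTheory.Measure.count : MeasureTheory.Measure ℤ)) hconj
    (f := f) (measurable_of_countable _)
  rw [pi_count_eq_count, MeasureTheory.lintegral_count, MeasureTheory.lintegral_count] at key
  rw [hS]
  refine le_trans (ENNReal.tsum_le_tsum fun x => ?_) key
  have hline : ∀ i, ENNReal.ofReal |v x| ≤ ∑' k : ℤ, f (Function.update x i k) := by
    intro i
    have hfin : (Function.support fun k : ℤ => v (Function.update x i k)).Finite :=
      hv.preimage (Function.update_injective x i).injOn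
    have h := ofReal_abs_le_tsum_abs_sub hfin (x i)
    rw [Function.update_eq_self] at h
    refine h.trans (ENNReal.tsum_le_tsum fun k => ?_)
    have hup : Function.update x i (k + 1) = Function.update x i k + Pi.single i 1 := by
      ext j
      by_cases hj : j = i
      · subst hj; simp
      · simp [hj]
    rw [hup]
    exact Finset.single_le_sum
      (f := fun i' => ENNReal.ofReal |v (Function.update x i k + Pi.single i' 1)
        - v (Function.update x i k)|) (fun _ _ => zero_le) (Finset.mem_univ i)
  calc ENNReal.ofReal |v x| ^ ((N : ℝ) / (N - 1))
      = ∏ _i : Fin N, ENNReal.ofReal |v x| ^ ((1 : ℝ) / (N - 1)) := by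
        rw [Finset.prod_const, Finset.card_univ, Fintype.card_fin, ← ENNReal.rpow_mul_natCast]
        congr 1
        ring
    _ ≤ _ := by
        refine Finset.prod_le_prod' fun i _ => ?_
        rw [MeasureTheory.lintegral_count, Fintype.card_fin]
        exact ENNReal.rpow_le_rpow (hline i) (by apply div_nonneg <;> linarith)

theorem abs_rpow_sub_rpow_le {γ : ℝ} (hγ : 1 ≤ γ) {b c : ℝ} (hb : 0 ≤ b) (hc : 0 ≤ c) :
    |b ^ γ - c ^ γ| ≤ γ * max b c ^ (γ - 1) * |b - c| := by
  wlog h : c ≤ b generalizing b c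
  · rw [abs_sub_comm, abs_sub_comm b, max_comm]
    exact this hc hb (le_of_not_ge h)
  rw [max_eq_left h, abs_of_nonneg (sub_nonneg.2 h),
    abs_of_nonneg (sub_nonneg.2 (Real.rpow_le_rpow hc h (by linarith)))]
  rcases hb.eq_or_lt with rfl | hb0
  · obtain rfl : c = 0 := le_antisymm h hc
    simp
  have hbern := one_add_mul_self_le_rpow_one_add (s := c / b - 1)
    (by have := div_nonneg hc hb; linarith) hγ
  rw [add_sub_cancel, Real.div_rpow hc hb, le_div_iff₀ (Real.rpow_pos_of_pos hb0 _)] at hbern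
  have hpow : b ^ γ = b ^ (γ - 1) * b := by
    rw [← Real.rpow_add_one hb0.ne', sub_add_cancel]
  have : (1 + γ * (c / b - 1)) * b ^ γ = b ^ γ - γ * b ^ (γ - 1) * (b - c) := by
    rw [hpow]; field_simp; ring
  linarith

theorem abs_le_one_of_vsum_le_one {N : ℕ} {r : ℝ} (hr : 0 < r) {u : ZN N → ℝ}
    (hu : vsum r u ≤ 1) (x : ZN N) : |u x| ≤ 1 := by
  have h : ENNReal.ofReal (|u x| ^ r) ≤ 1 := (ENNReal.le_tsum x).trans hu
  rw [ENNReal.ofReal_le_one] at h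
  by_contra! hx
  exact h.not_gt (Real.one_lt_rpow hx hr)

theorem abs_abs_rpow_sub_abs_rpow_le {κ γ : ℝ} (hκ : 0 < κ) (hκγ : κ ≤ γ - 1) {b c : ℝ}
    (hb : |b| ≤ 1) (hc : |c| ≤ 1) :
    |(|b| ^ γ - |c| ^ γ)| ≤ γ * (max |b| |c| ^ κ * |b - c|) := by
  have hm0 : 0 ≤ max |b| |c| := le_max_of_le_left (abs_nonneg _)
  have hγ : 1 ≤ γ := by linarith
  calc |(|b| ^ γ - |c| ^ γ)| ≤ γ * max |b| |c| ^ (γ - 1) * |(|b| - |c|)| :=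
        abs_rpow_sub_rpow_le hγ (abs_nonneg _) (abs_nonneg _)
    _ ≤ γ * max |b| |c| ^ κ * |b - c| := by
        gcongr ?_ * ?_ * ?_
        · exact Real.rpow_le_rpow_of_exponent_ge_of_imp hm0 (max_le hb hc) hκγ
            fun _ h => absurd h (by linarith)
        · exact abs_abs_sub_abs_le _ _
    _ = _ := by ring

theorem tsum_max_rpow_le {N : ℕ} (r : ℝ) (u : ZN N → ℝ) :
    ∑' z : ZN N × Fin N, ENNReal.ofReal (max |u (z.1 + Pi.single z.2 1)| |u z.1| ^ r)
      ≤ 2 * N * vsum r u := by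
  have hle : ∀ z : ZN N × Fin N,
      ENNReal.ofReal (max |u (z.1 + Pi.single z.2 1)| |u z.1| ^ r)
        ≤ ENNReal.ofReal (|u (z.1 + Pi.single z.2 1)| ^ r) + ENNReal.ofReal (|u z.1| ^ r) := by
    intro z
    rcases max_choice |u (z.1 + Pi.single z.2 1)| |u z.1| with h | h <;> rw [h]
    · exact le_self_add
    · exact le_add_self
  refine (ENNReal.tsum_le_tsum hle).trans_eq ?_
  rw [ENNReal.tsum_add, ENNReal.tsum_prod', ENNReal.tsum_prod', ENNReal.tsum_comm]
  have hshift : ∀ i : Fin N,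
      ∑' x : ZN N, ENNReal.ofReal (|u (x + Pi.single i 1)| ^ r) = vsum r u := fun i =>
    (Equiv.addRight (Pi.single i 1 : ZN N)).tsum_eq fun x => ENNReal.ofReal (|u x| ^ r)
  rw [ENNReal.tsum_comm (f := fun (x : ZN N) (_ : Fin N) => ENNReal.ofReal (|u x| ^ r))]
  simp only [hshift, tsum_fintype]
  change _ + ∑ _i : Fin N, vsum r u = _
  simp only [Finset.sum_const, Finset.card_univ, Fintype.card_fin, nsmul_eq_mul]
  ring

theorem forwardSum_one_rpow_le {N : ℕ} {p r γ : ℝ} (hp : 1 < p) (hr : 0 < r)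
    (hexp : r * ((p - 1) / p) ≤ γ - 1) {u : ZN N → ℝ} (hu : vsum r u ≤ 1) :
    forwardSum 1 (fun x => |u x| ^ γ)
      ≤ ENNReal.ofReal γ * ((2 * N * vsum r u) ^ ((p - 1) / p) * forwardSum p u ^ (1 / p)) := by
  have hp' : 0 < (p - 1) / p := div_pos (by linarith) (by linarith)
  have hγ : 0 ≤ γ := by linarith [mul_pos hr hp']
  have hu1 := abs_le_one_of_vsum_le_one hr hu
  set m : ZN N × Fin N → ℝ := fun z => max |u (z.1 + Pi.single z.2 1)| |u z.1|
  have hm0 : ∀ z, 0 ≤ m z := fun z => le_max_of_le_left (abs_nonneg _)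
  set F : ZN N × Fin N → ℝ≥0∞ := fun z => ENNReal.ofReal (m z ^ (r * ((p - 1) / p)))
  set D : ZN N × Fin N → ℝ≥0∞ :=
    fun z => ENNReal.ofReal |u (z.1 + Pi.single z.2 1) - u z.1|
  have hconj : Real.HolderConjugate (p / (p - 1)) p := (Real.HolderConjugate.conjExponent hp).symm
  have holder := ENNReal.lintegral_mul_le_Lp_mul_Lq MeasureTheory.Measure.count hconj
    (f := F) (g := D) (measurable_of_countable _).aemeasurable
    (measurable_of_countable _).aemeasurable
  simp only [MeasureTheory.lintegral_count] at holder
  have hF : ∑' z, F z ^ (p / (p - 1)) ≤ 2 * N * vsum r u := by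
    refine le_trans (ENNReal.tsum_le_tsum fun z => le_of_eq ?_) (tsum_max_rpow_le r u)
    rw [ENNReal.ofReal_rpow_of_nonneg (Real.rpow_nonneg (hm0 z) _)
      (div_nonneg (by linarith) (by linarith)), ← Real.rpow_mul (hm0 z)]
    congr 2
    have : p - 1 ≠ 0 := by linarith
    field_simp
  have hD : ∑' z, D z ^ p = forwardSum p u :=
    tsum_congr fun z => ENNReal.ofReal_rpow_of_nonneg (abs_nonneg _) (by linarith)
  rw [hD, one_div_div] at holder
  calc forwardSum 1 (fun x => |u x| ^ γ)
      ≤ ∑' z, ENNReal.ofReal γ * (F * D) z := by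
        refine ENNReal.tsum_le_tsum fun z => ?_
        rw [Real.rpow_one, Pi.mul_apply, ← ENNReal.ofReal_mul (Real.rpow_nonneg (hm0 z) _),
          ← ENNReal.ofReal_mul (by linarith)]
        exact ENNReal.ofReal_le_ofReal
          (abs_abs_rpow_sub_abs_rpow_le (mul_pos hr hp') hexp (hu1 _) (hu1 _))
    _ = ENNReal.ofReal γ * ∑' z, (F * D) z := ENNReal.tsum_mul_left
    _ ≤ _ := by
        gcongr
        exact holder.trans (by gcongr)

/-- A supercritical discrete Sobolev inequality for functions of small `ℓ^r` norm. -/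
theorem vsum_rpow_le_forwardSum {N : ℕ} (hN : 2 ≤ N) {p r : ℝ} (hp : 1 < p) (hpN : p < (N : ℝ))
    (hr : (N : ℝ) * p / ((N : ℝ) - p) < r) {u : ZN N → ℝ} (hfin : (Function.support u).Finite)
    (hu0 : vsum r u ≠ 0) (hu : vsum r u ≤ 1) :
    vsum r u ^ (1 - p / N)
      ≤ (ENNReal.ofReal (r * (N - 1) / N) * (2 * N) ^ ((p - 1) / p)) ^ p * forwardSum p u := by
  have hN' : (2 : ℝ) ≤ N := by exact_mod_cast hN
  have hN0 : (0 : ℝ) < N := by linarith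
  have hp0 : (0 : ℝ) < p := by linarith
  have hr0 : 0 < r := lt_trans (div_pos (by positivity) (by linarith)) hr
  rw [div_lt_iff₀ (by linarith)] at hr
  set γ := r * (N - 1) / N with hγdef
  have hexp : r * ((p - 1) / p) ≤ γ - 1 := by
    rw [hγdef, ← sub_nonneg]
    have : r * (N - 1) / N - 1 - r * ((p - 1) / p) = (r * (N - p) - N * p) / (N * p) := by
      field_simp; ring
    rw [this]
    exact div_nonneg (by linarith) (by positivity)
  have hγ : 1 ≤ γ := by
    have : 0 < r * ((p - 1) / p) := mul_pos hr0 (div_pos (by linarith) hp0)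
    linarith
  have h1 := forwardSum_one_rpow_le hp hr0 hexp hu
  have hfin' : (Function.support fun x => |u x| ^ γ).Finite :=
    hfin.subset fun x hx hux => hx (by simp [hux, Real.zero_rpow (by linarith : γ ≠ 0)])
  have h2 := tsum_rpow_le_forwardSum hN hfin'
  have hV : ∑' x, ENNReal.ofReal |(|u x| ^ γ)| ^ ((N : ℝ) / (N - 1)) = vsum r u := by
    refine tsum_congr fun x => ?_
    rw [abs_of_nonneg (Real.rpow_nonneg (abs_nonneg _) _), ENNReal.ofReal_rpow_of_nonneg
      (Real.rpow_nonneg (abs_nonneg _) _) (div_nonneg hN0.le (by linarith)),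
      ← Real.rpow_mul (abs_nonneg _)]
    congr 2
    have : (N : ℝ) - 1 ≠ 0 := by linarith
    rw [hγdef]
    field_simp
  rw [hV] at h2
  set V := vsum r u
  have hVtop : V ≠ ⊤ := ne_top_of_le_ne_top ENNReal.one_ne_top hu
  have h3 : V ^ (((N : ℝ) - 1) / N) ≤ forwardSum 1 fun x => |u x| ^ γ := by
    refine (ENNReal.rpow_le_rpow h2 (div_nonneg (by linarith) hN0.le)).trans_eq ?_
    rw [← ENNReal.rpow_mul]
    have : (N : ℝ) - 1 ≠ 0 := by linarith
    rw [show (N : ℝ) / (N - 1) * ((N - 1) / N) = 1 by field_simp, ENNReal.rpow_one]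
  have h4 := ENNReal.rpow_le_rpow (h3.trans h1) hp0.le
  have hp1 : 0 ≤ (p - 1) / p := div_nonneg (by linarith) hp0.le
  rw [ENNReal.mul_rpow_of_nonneg _ _ hp1,
    ENNReal.mul_rpow_of_nonneg _ _ hp0.le, ENNReal.mul_rpow_of_nonneg _ _ hp0.le,
    ENNReal.mul_rpow_of_nonneg _ _ hp0.le] at h4
  rw [← ENNReal.rpow_mul V, ← ENNReal.rpow_mul V, ← ENNReal.rpow_mul (forwardSum p u),
    div_mul_cancel₀ _ hp0.ne', div_mul_cancel₀ _ hp0.ne', ENNReal.rpow_one] at h4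
  have hsplit : V ^ (((N : ℝ) - 1) / N * p) = V ^ (1 - p / N) * V ^ (p - 1) := by
    rw [← ENNReal.rpow_add _ _ hu0 hVtop]
    congr 1
    field_simp
    ring
  rw [hsplit] at h4
  rw [ENNReal.mul_rpow_of_nonneg _ _ hp0.le]
  have hc0 : V ^ (p - 1) ≠ 0 := by simp [ENNReal.rpow_eq_zero_iff, hu0, hVtop]
  have hct : V ^ (p - 1) ≠ ⊤ := ENNReal.rpow_ne_top_of_ne_zero hu0 hVtop
  refine (ENNReal.mul_le_mul_iff_left hc0 hct).1 (h4.trans_eq ?_)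
  ring

theorem adj_add_single {N : ℕ} (x : ZN N) (i : Fin N) : adj x (x + Pi.single i 1) := by
  unfold adj
  rw [Finset.sum_eq_single i]
  · simp
  · intro j _ hj; simp [hj]
  · simp

theorem forwardSum_le_energy {N : ℕ} {p q : ℝ} (hp : 0 < p) (hq : 0 < q) {a : ZN N → ℝ}
    (ha : ∀ x, 0 ≤ a x) (u : ZN N → ℝ) :
    ENNReal.ofReal (1 / p) * forwardSum p u / 2 ≤ energy p q a u := by
  unfold energy eInt forwardSum
  gcongr
  rw [← ENNReal.tsum_mul_left]
  have hinj : Function.Injective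
      fun z : ZN N × Fin N => ((z.1, z.1 + Pi.single z.2 1) : ZN N × ZN N) := by
    rintro ⟨x, i⟩ ⟨y, j⟩ h
    obtain ⟨rfl, h⟩ := Prod.mk.inj h
    have h' := congrFun (add_left_cancel h) i
    by_cases hij : i = j
    · rw [hij]
    · simp [hij] at h'
  refine le_trans (ENNReal.tsum_le_tsum fun z => ?_)
    (ENNReal.tsum_comp_le_tsum_of_injective hinj _)
  rw [if_pos (adj_add_single _ _), ← ENNReal.ofReal_mul (by positivity)]
  refine ENNReal.ofReal_le_ofReal (le_add_of_nonneg_right ?_)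
  have := ha z.1
  positivity

theorem energy_const_mul_le {N : ℕ} {p q : ℝ} (hp : 0 < p) (hpq : p ≤ q)
    (a u : ZN N → ℝ) {c : ℝ} (hc : 1 ≤ c) :
    energy p q a (fun x => c * u x) ≤ ENNReal.ofReal (c ^ q) * energy p q a u := by
  unfold energy eInt
  rw [← mul_div_assoc, ← ENNReal.tsum_mul_left]
  gcongr with e
  split_ifs
  · rw [← ENNReal.ofReal_mul (by positivity)]
    refine ENNReal.ofReal_le_ofReal ?_
    have hg : |grad (fun x => c * u x) e.1 e.2| = c * |grad u e.1 e.2| := by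
      unfold grad
      rw [← mul_sub, abs_mul, abs_of_nonneg (by linarith)]
    beta_reduce
    rw [hg, Real.mul_rpow (by linarith) (abs_nonneg _), Real.mul_rpow (by linarith) (abs_nonneg _),
      mul_add]
    have hcpq : c ^ p ≤ c ^ q := Real.rpow_le_rpow_of_exponent_le hc hpq
    have h0 : 0 ≤ |grad u e.1 e.2| ^ p := Real.rpow_nonneg (abs_nonneg _) _
    have h1 : 1 / p * (c ^ p * |grad u e.1 e.2| ^ p) ≤ c ^ q * (1 / p * |grad u e.1 e.2| ^ p) := by
      rw [mul_left_comm]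
      gcongr
    linarith [mul_left_comm (c ^ q) (a e.1 / q) (|grad u e.1 e.2| ^ q)]
  · simp

theorem energy_single_ne_top {N : ℕ} {p q : ℝ} (hp : 0 < p) (hq : 0 < q) (a : ZN N → ℝ) :
    energy p q a (Pi.single 0 1) ≠ ⊤ := by
  unfold energy eInt
  refine ENNReal.div_ne_top ?_ two_ne_zero
  rw [tsum_eq_sum (s := Finset.Icc (-1 : ZN N × ZN N) 1)]
  · refine ENNReal.sum_ne_top.2 fun e _ => ?_
    split_ifs <;> simp
  · intro e he
    split_ifs with hadj
    · have hle : ∀ i, (e.1 i - e.2 i).natAbs ≤ 1 := fun i =>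
        (Finset.single_le_sum (f := fun i => (e.1 i - e.2 i).natAbs)
          (fun _ _ => Nat.zero_le _) (Finset.mem_univ i)).trans_eq hadj
      have hgrad : grad (Pi.single 0 1 : ZN N → ℝ) e.1 e.2 = 0 := by
        have h1 : e.1 ≠ 0 := fun h => he <| by
          simp only [h, Pi.zero_apply] at hle
          rw [Finset.mem_Icc]
          refine ⟨⟨?_, ?_⟩, ?_, ?_⟩ <;> intro i <;> have := hle i <;> simp [h] <;> lia
        have h2 : e.2 ≠ 0 := fun h => he <| by
          simp only [h, Pi.zero_apply] at hle
          rw [Finset.mem_Icc]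
          refine ⟨⟨?_, ?_⟩, ?_, ?_⟩ <;> intro i <;> have := hle i <;> simp [h] <;> lia
        simp [grad, h1, h2]
      beta_reduce
      rw [hgrad]
      simp [Real.zero_rpow hp.ne', Real.zero_rpow hq.ne']
    · rfl

theorem Slevel_le_rpow_mul {N : ℕ} {p q r t : ℝ} (hp : 0 < p) (hpq : p ≤ q) (hr : 0 < r)
    (a : ZN N → ℝ) (ht : 1 ≤ r * t) :
    Slevel p q a r t ≤ ENNReal.ofReal ((r * t) ^ (q / r)) * energy p q a (Pi.single 0 1) := by
  set c := (r * t) ^ (1 / r) with hc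
  have hrt0 : 0 ≤ r * t := by linarith
  have hcq : c ^ q = (r * t) ^ (q / r) := by
    rw [hc, ← Real.rpow_mul hrt0]; congr 1; ring
  have hcr : c ^ r = r * t := by
    rw [hc, ← Real.rpow_mul hrt0, one_div_mul_cancel hr.ne', Real.rpow_one]
  have hc0 : 0 ≤ c := Real.rpow_nonneg hrt0 _
  rw [← hcq]
  refine le_trans (sInf_le ⟨fun x => c * (Pi.single 0 1 : ZN N → ℝ) x, ?_, ?_, rfl⟩)
    (energy_const_mul_le hp hpq a _ (Real.one_le_rpow ht (by positivity)))
  · refine (Set.finite_singleton (0 : ZN N)).subset fun x hx => ?_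
    by_contra hne
    exact hx (by simp [show x ≠ 0 from hne])
  · unfold vsum
    rw [tsum_eq_single 0]
    · simp [abs_of_nonneg hc0, hcr]
    · intro x hx
      simp [hx, Real.zero_rpow hr.ne']

theorem div_le_Slevel {N : ℕ} (hN : 2 ≤ N) {p q r t : ℝ} (hp : 1 < p) (hpN : p < (N : ℝ))
    (hq : 0 < q) (hr : (N : ℝ) * p / ((N : ℝ) - p) < r) {a : ZN N → ℝ} (ha : ∀ x, 0 ≤ a x)
    (ht : 0 < r * t) (ht1 : r * t ≤ 1) :
    ENNReal.ofReal ((r * t) ^ (1 - p / N)) / (ENNReal.ofReal p * 2 *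
      (ENNReal.ofReal (r * (N - 1) / N) * (2 * N) ^ ((p - 1) / p)) ^ p) ≤ Slevel p q a r t := by
  have hp0 : 0 < p := by linarith
  refine le_sInf ?_
  rintro _ ⟨u, hfin, hV, rfl⟩
  refine ENNReal.div_le_of_le_mul ?_
  have h1 := vsum_rpow_le_forwardSum hN hp hpN hr hfin
    (by rw [hV]; simpa using ht) (by rw [hV]; simpa using ht1)
  rw [hV, ENNReal.ofReal_rpow_of_pos ht] at h1
  refine h1.trans ?_
  have hG : forwardSum p u =
      ENNReal.ofReal p * 2 * (ENNReal.ofReal (1 / p) * forwardSum p u / 2) := by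
    rw [mul_assoc, ENNReal.mul_div_cancel two_ne_zero ENNReal.ofNat_ne_top, ← mul_assoc,
      ← ENNReal.ofReal_mul hp0.le, mul_one_div_cancel hp0.ne', ENNReal.ofReal_one, one_mul]
  rw [hG, mul_left_comm, ← mul_assoc, mul_comm (energy p q a u)]
  gcongr
  exact forwardSum_le_energy hp0 hq ha u

/-- `S_t / t → 0` as `t → +∞` and `S_t / t → +∞` as `t → 0⁺`,
for `r > max(q, p*)` and arbitrary nonnegative weight `a`. -/
theorem statement5 {N : ℕ} (hN : 2 ≤ N) (p q : ℝ) (hp : 1 < p) (hpN : p < (N : ℝ))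
    (hpq : p < q) (pstar : ℝ) (hpstar : pstar = (N : ℝ) * p / ((N : ℝ) - p))
    (r : ℝ) (hr : max q pstar < r)
    (a : ZN N → ℝ) (ha : ∀ x, 0 ≤ a x) :
    Tendsto (fun t : ℝ => Slevel p q a r t / ENNReal.ofReal t) atTop (𝓝 0) ∧
    Tendsto (fun t : ℝ => Slevel p q a r t / ENNReal.ofReal t) (𝓝[>] (0 : ℝ)) (𝓝 ⊤) := by
  obtain ⟨hqr, hr⟩ := max_lt_iff.1 hr
  subst hpstar
  have hp0 : 0 < p := by linarith
  have hq0 : 0 < q := by linarith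
  have hr0 : 0 < r := by linarith
  have hN0 : (0 : ℝ) < N := by linarith
  constructor
  · have hreal : Tendsto (fun t : ℝ => r ^ (q / r) * t ^ (-(1 - q / r))) atTop (𝓝 0) := by
      have hlt : q / r < 1 := (div_lt_one hr0).2 hqr
      simpa using (tendsto_rpow_neg_atTop (sub_pos.2 hlt)).const_mul (r ^ (q / r))
    have hE := energy_single_ne_top hp0 hq0 a
    have hlim := ENNReal.Tendsto.mul_const (ENNReal.tendsto_ofReal hreal) (.inr hE)
    rw [ENNReal.ofReal_zero, zero_mul] at hlim
    refine tendsto_of_tendsto_of_tendsto_of_le_of_le' tendsto_const_nhds hlim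
      (.of_forall fun _ => zero_le) ?_
    filter_upwards [eventually_ge_atTop (1 / r), eventually_gt_atTop 0] with t ht ht0
    have h := Slevel_le_rpow_mul hp0 hpq.le hr0 a ((div_le_iff₀' hr0).1 ht)
    refine ENNReal.div_le_of_le_mul (h.trans_eq ?_)
    rw [mul_right_comm, ← ENNReal.ofReal_mul (by positivity)]
    congr 2
    rw [Real.mul_rpow hr0.le ht0.le, mul_assoc, ← Real.rpow_add_one ht0.ne']
    congr 2
    ring
  · set K : ℝ≥0∞ := ENNReal.ofReal p * 2 *
      (ENNReal.ofReal (r * (N - 1) / N) * (2 * N) ^ ((p - 1) / p)) ^ p with hK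
    have hKtop : K ≠ ⊤ := by
      have hpp : 0 ≤ (p - 1) / p := div_nonneg (by linarith) hp0.le
      exact ENNReal.mul_ne_top (ENNReal.mul_ne_top ENNReal.ofReal_ne_top (by simp))
        (ENNReal.rpow_ne_top_of_nonneg hp0.le (ENNReal.mul_ne_top ENNReal.ofReal_ne_top
        (ENNReal.rpow_ne_top_of_nonneg hpp (ENNReal.mul_ne_top (by simp) (by simp)))))
    have hreal : Tendsto (fun t : ℝ => r ^ (1 - p / N) * t ^ (-(p / N))) (𝓝[>] 0) atTop :=
      (tendsto_rpow_neg_nhdsGT_zero (neg_lt_zero.2 (div_pos hp0 hN0))).const_mul_atTop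
        (Real.rpow_pos_of_pos hr0 _)
    have hlim := ENNReal.Tendsto.div_const (ENNReal.tendsto_ofReal_atTop.comp hreal)
      (b := K) (.inl ENNReal.top_ne_zero)
    rw [ENNReal.top_div_of_ne_top hKtop] at hlim
    refine tendsto_of_tendsto_of_tendsto_of_le_of_le' hlim tendsto_const_nhds ?_
      (.of_forall fun _ => le_top)
    filter_upwards [Ioo_mem_nhdsGT (one_div_pos.2 hr0)] with t ht
    have h := div_le_Slevel hN hp hpN hq0 hr ha (mul_pos hr0 ht.1) ((lt_div_iff₀' hr0).1 ht.2).le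
    rw [← hK] at h
    refine le_trans (le_of_eq ?_) (ENNReal.div_le_div_right h _)
    rw [ENNReal.div_right_comm, Function.comp_apply, ← ENNReal.ofReal_div_of_pos ht.1]
    congr 2
    rw [Real.mul_rpow hr0.le ht.1.le, mul_div_assoc, ← Real.rpow_sub_one ht.1.ne']
    congr 2
    ring
end
end

section
/- Let N ≥ 1, 1 < q < ∞, and let a : ℤ^N → [0,∞) satisfy a(x) → +∞ as |x| → ∞. Let v_n : ℤ^N → ℝ be a sequence such that ∇v_n(x,y) → 0 as n → ∞ for every edge (x,y) ∈ E, and such that sup_n ∫_E a(x)|∇v_n|^q dw < ∞. Then ∫_E |∇v_n|^q dw → 0 as n → ∞. -/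
open Filter Topology
open scoped ENNReal Classical

noncomputable section

lemma ENNReal.tendsto_tsum_zero_of_mul_le_off_finset {ι : Type*} {f g : ℕ → ι → ℝ≥0∞}
    (hf : ∀ i, Tendsto (fun n => f n i) atTop (𝓝 0)) {C : ℝ≥0∞} (hC : C ≠ ⊤)
    (hg : ∀ n, ∑' i, g n i ≤ C)
    (hfg : ∀ K : ℕ, ∃ T : Finset ι, ∀ n, ∀ i ∉ T, K * f n i ≤ g n i) :
    Tendsto (fun n => ∑' i, f n i) atTop (𝓝 0) := by
  rw [ENNReal.tendsto_nhds_zero]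
  intro ε hε
  have hε2 : ε / 2 ≠ 0 := (ENNReal.half_pos hε.ne').ne'
  obtain ⟨K, hK⟩ := ENNReal.exists_nat_mul_gt hε2 hC
  obtain ⟨T, hT⟩ := hfg K
  have hfin : Tendsto (fun n => ∑ i ∈ T, f n i) atTop (𝓝 0) := by
    simpa using tendsto_finsetSum T fun i _ => hf i
  filter_upwards [ENNReal.tendsto_nhds_zero.1 hfin (ε / 2) (pos_iff_ne_zero.2 hε2)] with n hn
  have hmul : (K : ℝ≥0∞) * ∑' i : ↥((T : Set ι)ᶜ), f n i ≤ C :=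
    calc (K : ℝ≥0∞) * ∑' i : ↥((T : Set ι)ᶜ), f n i
        = ∑' i : ↥((T : Set ι)ᶜ), K * f n i := ENNReal.tsum_mul_left.symm
      _ ≤ ∑' i : ↥((T : Set ι)ᶜ), g n i :=
          ENNReal.tsum_le_tsum fun i => hT n i i.2
      _ ≤ ∑' i, g n i := ENNReal.tsum_comp_le_tsum_of_injective Subtype.val_injective (g n)
      _ ≤ C := hg n
  have htail : ∑' i : ↥((T : Set ι)ᶜ), f n i ≤ ε / 2 :=
    (lt_of_mul_lt_mul_left (hmul.trans_lt hK) zero_le).le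
  calc ∑' i, f n i = ∑ i ∈ T, f n i + ∑' i : ↥((T : Set ι)ᶜ), f n i :=
        (ENNReal.sum_add_tsum_compl T (f n)).symm
    _ ≤ ε / 2 + ε / 2 := add_le_add hn htail
    _ = ε := ENNReal.add_halves ε

lemma adj.mem_Icc {N : ℕ} {x y : ZN N} (h : adj x y) : y ∈ Finset.Icc (x - 1) (x + 1) := by
  have hi (i : Fin N) : (x i - y i).natAbs ≤ 1 :=
    (Finset.single_le_sum (f := fun i => (x i - y i).natAbs) (fun _ _ => Nat.zero_le _)
      (Finset.mem_univ i)).trans_eq h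
  rw [Finset.mem_Icc, Pi.le_def, Pi.le_def]
  constructor <;> intro i <;> have := hi i <;> simp only [Pi.sub_apply, Pi.add_apply, Pi.one_apply]
    <;> omega

/-- if `a(x) → +∞` as `|x| → ∞`, `∇v_n → 0` pointwise on edges, and
`∫_E a(x)|∇v_n|^q dw` is uniformly bounded, then `∫_E |∇v_n|^q dw → 0`. -/
theorem statement15 {N : ℕ} (hN : 1 ≤ N) (q : ℝ) (hq : 1 < q)
    (a : ZN N → ℝ) (ha : ∀ x, 0 ≤ a x) (hainf : Tendsto a cofinite atTop)
    (v : ℕ → ZN N → ℝ)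
    (hgrad : ∀ x y : ZN N, adj x y → Tendsto (fun n => grad (v n) x y) atTop (𝓝 0))
    (hbd : ∃ C : ℝ≥0∞, C ≠ ⊤ ∧ ∀ n, eInt (fun x y => a x * |grad (v n) x y| ^ q) ≤ C) :
    Tendsto (fun n => eInt (fun x y => |grad (v n) x y| ^ q)) atTop (𝓝 0) := by
  obtain ⟨C, hC, hCb⟩ := hbd
  have hzero (e : ZN N × ZN N) : Tendsto (fun n => if adj e.1 e.2 then
      ENNReal.ofReal (|grad (v n) e.1 e.2| ^ q) else 0) atTop (𝓝 0) := by
    split_ifs with he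
    · have h := ENNReal.tendsto_ofReal
        ((hgrad _ _ he).abs.rpow_const (p := q) (Or.inr (by linarith)))
      simpa [Real.zero_rpow (by linarith : q ≠ 0)] using h
    · exact tendsto_const_nhds
  have hbound (n : ℕ) : ∑' e : ZN N × ZN N, (if adj e.1 e.2 then
      ENNReal.ofReal (a e.1 * |grad (v n) e.1 e.2| ^ q) else 0) ≤ C * 2 :=
    (ENNReal.div_le_iff two_ne_zero ENNReal.ofNat_ne_top).1 (hCb n)
  have key := ENNReal.tendsto_tsum_zero_of_mul_le_off_finset hzero
    (ENNReal.mul_ne_top hC ENNReal.ofNat_ne_top) hbound fun K => by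
      have hfin : {x | ¬ (K : ℝ) ≤ a x}.Finite := hainf.eventually_ge_atTop (K : ℝ)
      refine ⟨hfin.toFinset.biUnion fun x => {x} ×ˢ Finset.Icc (x - 1) (x + 1),
        fun n e he => ?_⟩
      split_ifs with hadj
      · have hK : (K : ℝ) ≤ a e.1 := by
          by_contra hlt
          refine he (Finset.mem_biUnion.2 ⟨e.1, by simpa using hlt, ?_⟩)
          exact Finset.mem_product.2 ⟨Finset.mem_singleton_self _, hadj.mem_Icc⟩
        rw [← ENNReal.ofReal_natCast, ← ENNReal.ofReal_mul K.cast_nonneg]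
        exact ENNReal.ofReal_le_ofReal (by gcongr)
      · simp
  simpa [eInt] using ENNReal.Tendsto.div_const key (Or.inr two_ne_zero)
end
end

section
/- Let N ≥ 2, 1 < p < N, p < q < ∞, p* := Np/(N−p), r > p*, and let a : ℤ^N → [0,∞) be bounded. Set S := inf{ I(u) : u finitely supported, Σ_x |u(x)|^r = 1 }. Let v_n : ℤ^N → ℝ be finitely supported with Σ_x |v_n(x)|^r = 1 and I(v_n) → S, let y_n ∈ ℤ^N be an arbitrary sequence, and put u_n(x) := v_n(x + y_n) and a_n(x) := a(x + y_n). Then there exist a subsequence (n_k) and functions u : ℤ^N → ℝ and ã : ℤ^N → [0,∞) such that: u_{n_k} → u pointwise on ℤ^N; a_{n_k} → ã pointwise on ℤ^N; sup_k ∫_E |∇u_{n_k}|^p dw < ∞ and sup_k ∫_E a_{n_k}(x)|∇u_{n_k}|^q dw < ∞; ∫_E |∇u|^q dw < ∞ and lim_k ∫_E |a_{n_k}(x)^{1/q} ∇u − ã(x)^{1/q} ∇u|^q dw = 0; and limsup_k ∫_E a_{n_k}(x)|∇(u_{n_k} − u)|^q dw ≤ liminf_k ∫_E |a_{n_k}(x)^{1/q}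 ∇u_{n_k} − ã(x)^{1/q} ∇u|^q dw. -/
open Filter Topology
open scoped ENNReal Classical

noncomputable section

open MeasureTheory

lemma adj_add_right {N : ℕ} (t x y : ZN N) : adj (x + t) (y + t) ↔ adj x y := by
  simp [adj]

/-- The measure on pairs of vertices whose integral is the edge integral. -/
def edgeMeasure (N : ℕ) : Measure (ZN N × ZN N) :=
  (2⁻¹ : ℝ≥0∞) • Measure.count.restrict {e | adj e.1 e.2}

lemma eInt_eq_lintegral {N : ℕ} (g : ZN N → ZN N → ℝ) :
    eInt g = ∫⁻ e, ENNReal.ofReal (g e.1 e.2) ∂edgeMeasure N := by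
  rw [edgeMeasure, lintegral_smul_measure,
    ← lintegral_indicator (Set.to_countable _).measurableSet, lintegral_count, eInt,
    ENNReal.div_eq_inv_mul, smul_eq_mul]
  rfl

lemma eInt_mono {N : ℕ} {g h : ZN N → ZN N → ℝ} (hgh : ∀ x y, g x y ≤ h x y) :
    eInt g ≤ eInt h := by
  simp only [eInt_eq_lintegral]
  exact lintegral_mono fun e => ENNReal.ofReal_le_ofReal (hgh _ _)

lemma eInt_const_mul {N : ℕ} (g : ZN N → ZN N → ℝ) {c : ℝ} (hc : 0 ≤ c) :
    eInt (fun x y => c * g x y) = ENNReal.ofReal c * eInt g := by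
  simp only [eInt_eq_lintegral, ENNReal.ofReal_mul hc]
  exact lintegral_const_mul _ (measurable_of_countable _)

lemma eInt_translate {N : ℕ} (g : ZN N → ZN N → ℝ) (t : ZN N) :
    eInt (fun x y => g (x + t) (y + t)) = eInt g := by
  unfold eInt
  congr 1
  rw [← ((Equiv.addRight t).prodCongr (Equiv.addRight t)).tsum_eq
    (fun e : ZN N × ZN N => if adj e.1 e.2 then ENNReal.ofReal (g e.1 e.2) else 0)]
  simp [adj_add_right]

lemma energy_translate {N : ℕ} (p q : ℝ) (a u : ZN N → ℝ) (t : ZN N) :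
    energy p q (fun x => a (x + t)) (fun x => u (x + t)) = energy p q a u :=
  eInt_translate (fun x y => (1 / p) * |grad u x y| ^ p + (a x / q) * |grad u x y| ^ q) t

lemma finite_setOf_adj_mem {N : ℕ} {s : Set (ZN N)} (hs : s.Finite) :
    {e : ZN N × ZN N | adj e.1 e.2 ∧ (e.1 ∈ s ∨ e.2 ∈ s)}.Finite := by
  have hd : (Set.Icc (-1 : ZN N) 1).Finite := Set.finite_Icc _ _
  refine ((hs.image2 (fun x d => (x, x + d)) hd).union
    (hs.image2 (fun x d => (x + d, x)) hd)).subset ?_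
  rintro ⟨x, y⟩ ⟨hadj, hmem⟩
  have hle (i : Fin N) : (x i - y i).natAbs ≤ 1 :=
    (Finset.single_le_sum (f := fun i => (x i - y i).natAbs)
      (fun _ _ => Nat.zero_le _) (Finset.mem_univ i)).trans hadj.le
  rcases hmem with h | h
  · refine Or.inl ⟨x, h, y - x, ⟨fun i => ?_, fun i => ?_⟩, by simp⟩ <;>
    · have := hle i
      simp only [Pi.neg_apply, Pi.one_apply, Pi.sub_apply]
      omega
  · refine Or.inr ⟨y, h, x - y, ⟨fun i => ?_, fun i => ?_⟩, by simp⟩ <;>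
    · have := hle i
      simp only [Pi.neg_apply, Pi.one_apply, Pi.sub_apply]
      omega

lemma energy_lt_top {N : ℕ} {p q : ℝ} (hp : 0 < p) (hq : 0 < q) (a : ZN N → ℝ) {u : ZN N → ℝ}
    (hu : (Function.support u).Finite) : energy p q a u < ⊤ := by
  refine ENNReal.div_lt_top ?_ two_ne_zero
  rw [tsum_eq_sum (s := (finite_setOf_adj_mem hu).toFinset)]
  · refine (ENNReal.sum_lt_top.2 fun e _ => ?_).ne
    split_ifs <;> simp
  · intro e he
    simp only [Set.Finite.mem_toFinset, Set.mem_ofPred_eq, Function.mem_support] at he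
    split_ifs with h
    · have h1 : u e.1 = 0 := by
        by_contra h1
        exact he ⟨h, Or.inl h1⟩
      have h2 : u e.2 = 0 := by
        by_contra h2
        exact he ⟨h, Or.inr h2⟩
      simp [grad, h1, h2, Real.zero_rpow hp.ne', Real.zero_rpow hq.ne']
    · rfl

lemma eInt_rpow_grad_le_energy {N : ℕ} {p q : ℝ} (hp : 0 < p) (hq : 0 < q) {a : ZN N → ℝ}
    (ha : ∀ x, 0 ≤ a x) (u : ZN N → ℝ) :
    eInt (fun x y => |grad u x y| ^ p) ≤ ENNReal.ofReal p * energy p q a u := by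
  rw [energy, ← eInt_const_mul _ hp.le]
  refine eInt_mono fun x y => ?_
  have h : 0 ≤ p * ((a x / q) * |grad u x y| ^ q) := by
    have := ha x
    positivity
  rw [mul_add, ← mul_assoc, mul_one_div_cancel hp.ne', one_mul]
  linarith

lemma eInt_weighted_rpow_grad_le_energy {N : ℕ} {p q : ℝ} (hp : 0 < p) (hq : 0 < q)
    (a u : ZN N → ℝ) :
    eInt (fun x y => a x * |grad u x y| ^ q) ≤ ENNReal.ofReal q * energy p q a u := by
  rw [energy, ← eInt_const_mul _ hq.le]
  refine eInt_mono fun x y => ?_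
  have h : 0 ≤ q * ((1 / p) * |grad u x y| ^ p) := by positivity
  rw [mul_add, ← mul_assoc q (a x / q), mul_div_cancel₀ _ hq.ne']
  linarith

lemma abs_le_one_of_vsum_eq_one {N : ℕ} {r : ℝ} (hr : 0 < r) {u : ZN N → ℝ}
    (hu : vsum r u = 1) (x : ZN N) : |u x| ≤ 1 := by
  have h : ENNReal.ofReal (|u x| ^ r) ≤ 1 := by
    rw [← hu]
    exact ENNReal.le_tsum x
  rw [ENNReal.ofReal_le_one] at h
  by_contra! h1
  exact absurd (Real.one_lt_rpow h1 hr) h.not_gt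

lemma eInt_le_of_tendsto {N : ℕ} {g : ℕ → ZN N → ZN N → ℝ} {G : ZN N → ZN N → ℝ} {C : ℝ≥0∞}
    (hg : ∀ x y, Tendsto (fun n => g n x y) atTop (𝓝 (G x y))) (hC : ∀ n, eInt (g n) ≤ C) :
    eInt G ≤ C := by
  simp only [eInt_eq_lintegral] at hC ⊢
  calc ∫⁻ e, ENNReal.ofReal (G e.1 e.2) ∂edgeMeasure N
      = ∫⁻ e, liminf (fun n => ENNReal.ofReal (g n e.1 e.2)) atTop ∂edgeMeasure N :=
        lintegral_congr fun e => ((ENNReal.tendsto_ofReal (hg e.1 e.2)).liminf_eq).symm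
    _ ≤ liminf (fun n => ∫⁻ e, ENNReal.ofReal (g n e.1 e.2) ∂edgeMeasure N) atTop :=
        lintegral_liminf_le fun n => measurable_of_countable _
    _ ≤ C := liminf_le_of_le (by isBoundedDefault) fun b hb =>
        let ⟨n, hn⟩ := hb.exists
        hn.trans (hC n)

lemma tendsto_eInt_of_dominated {N : ℕ} {g : ℕ → ZN N → ZN N → ℝ} {G B : ZN N → ZN N → ℝ}
    (hB : eInt B ≠ ⊤) (hgB : ∀ n x y, g n x y ≤ B x y)
    (hg : ∀ x y, Tendsto (fun n => g n x y) atTop (𝓝 (G x y))) :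
    Tendsto (fun n => eInt (g n)) atTop (𝓝 (eInt G)) := by
  simp only [eInt_eq_lintegral] at hB ⊢
  exact tendsto_lintegral_of_dominated_convergence (fun e => ENNReal.ofReal (B e.1 e.2))
    (fun n => measurable_of_countable _)
    (fun n => ae_of_all _ fun e => ENNReal.ofReal_le_ofReal (hgB _ _ _)) hB
    (ae_of_all _ fun e => ENNReal.tendsto_ofReal (hg _ _))

/-- Minkowski's inequality for edge integrals. -/
lemma eInt_rpow_abs_add_le {N : ℕ} {q : ℝ} (hq : 1 ≤ q) (f g : ZN N → ZN N → ℝ) :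
    eInt (fun x y => |f x y + g x y| ^ q) ≤
      (eInt (fun x y => |f x y| ^ q) ^ (1 / q) + eInt (fun x y => |g x y| ^ q) ^ (1 / q)) ^ q := by
  have hq0 : 0 < q := zero_lt_one.trans_le hq
  have hoq (t : ℝ) : ENNReal.ofReal (|t| ^ q) = ENNReal.ofReal |t| ^ q :=
    (ENNReal.ofReal_rpow_of_nonneg (abs_nonneg t) hq0.le).symm
  simp only [eInt_eq_lintegral, hoq]
  let F : ZN N × ZN N → ℝ≥0∞ := fun e => ENNReal.ofReal |f e.1 e.2|
  let G : ZN N × ZN N → ℝ≥0∞ := fun e => ENNReal.ofReal |g e.1 e.2|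
  have key := ENNReal.lintegral_Lp_add_le (μ := edgeMeasure N) (f := F) (g := G)
    (measurable_of_countable _).aemeasurable (measurable_of_countable _).aemeasurable hq
  calc _ ≤ ∫⁻ e, (F + G) e ^ q ∂edgeMeasure N := by
        refine lintegral_mono fun e => ENNReal.rpow_le_rpow ?_ hq0.le
        rw [Pi.add_apply, ← ENNReal.ofReal_add (abs_nonneg _) (abs_nonneg _)]
        exact ENNReal.ofReal_le_ofReal (abs_add_le _ _)
    _ = ((∫⁻ e, (F + G) e ^ q ∂edgeMeasure N) ^ (1 / q)) ^ q := by
        rw [← ENNReal.rpow_mul, one_div_mul_cancel hq0.ne', ENNReal.rpow_one]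
    _ ≤ _ := ENNReal.rpow_le_rpow key hq0.le

lemma abs_rpow_inv_sub_rpow_inv_rpow_le {s t q A : ℝ} (hq : 0 < q) (hs : 0 ≤ s) (ht : 0 ≤ t) (hsA : s ≤ A)
    (htA : t ≤ A) : |s ^ (1 / q) - t ^ (1 / q)| ^ q ≤ A := by
  have hA : 0 ≤ A := hs.trans hsA
  have h1 := Real.rpow_le_rpow hs hsA (one_div_pos.2 hq).le
  have h2 := Real.rpow_le_rpow ht htA (one_div_pos.2 hq).le
  have h3 := Real.rpow_nonneg hs (1 / q)
  have h4 := Real.rpow_nonneg ht (1 / q)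
  calc |s ^ (1 / q) - t ^ (1 / q)| ^ q ≤ (A ^ (1 / q)) ^ q :=
        Real.rpow_le_rpow (abs_nonneg _) (abs_le.2 ⟨by linarith, by linarith⟩) hq.le
    _ = A := by rw [← Real.rpow_mul hA, one_div_mul_cancel hq.ne', Real.rpow_one]

lemma exists_subseq_tendsto_of_bounded {ι : Type*} [Countable ι] {f : ℕ → ι → ℝ} {l m : ℝ}
    (hf : ∀ n i, f n i ∈ Set.Icc l m) :
    ∃ φ : ℕ → ℕ, StrictMono φ ∧ ∃ F : ι → ℝ, (∀ i, F i ∈ Set.Icc l m) ∧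
      ∀ i, Tendsto (fun k => f (φ k) i) atTop (𝓝 (F i)) := by
  obtain ⟨F, hF, φ, hφ, h⟩ :=
    (isCompact_univ_pi fun _ : ι => isCompact_Icc (a := l) (b := m)).tendsto_subseq
      (x := f) fun n i _ => hf n i
  exact ⟨φ, hφ, F, fun i => hF i trivial, fun i => tendsto_pi_nhds.1 h i⟩


/-- key translation lemma: for a bounded weight `a` and a minimizing
sequence `v_n` of the constrained problem, the translated sequences
`u_n(x) = v_n(x+y_n)`, `a_n(x) = a(x+y_n)` have a subsequence along which `u_n → u` and
`a_n → ã` pointwise, with uniform gradient bounds, `∫_E |∇u|^q dw < ∞`,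
`∫_E |a_n^{1/q}∇u − ã^{1/q}∇u|^q dw → 0`, and
`limsup ∫_E a_n|∇(u_n−u)|^q dw ≤ liminf ∫_E |a_n^{1/q}∇u_n − ã^{1/q}∇u|^q dw`. -/
theorem statement19 {N : ℕ} (hN : 2 ≤ N) (p q : ℝ) (hp : 1 < p) (hpN : p < (N : ℝ))
    (hpq : p < q) (pstar : ℝ) (hpstar : pstar = (N : ℝ) * p / ((N : ℝ) - p))
    (r : ℝ) (hr : pstar < r)
    (a : ZN N → ℝ) (ha : ∀ x, 0 ≤ a x) (habd : ∃ A : ℝ, ∀ x, a x ≤ A)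
    (v : ℕ → ZN N → ℝ) (hvfin : ∀ n, (Function.support (v n)).Finite)
    (hvr : ∀ n, vsum r (v n) = 1)
    (hvmin : Tendsto (fun n => energy p q a (v n)) atTop
      (𝓝 (sInf { c : ℝ≥0∞ | ∃ u : ZN N → ℝ, (Function.support u).Finite ∧
          vsum r u = 1 ∧ energy p q a u = c })))
    (y : ℕ → ZN N) :
    ∃ φ : ℕ → ℕ, StrictMono φ ∧
      ∃ u atil : ZN N → ℝ, (∀ z, 0 ≤ atil z) ∧
        (∀ z : ZN N, Tendsto (fun k => v (φ k) (z + y (φ k))) atTop (𝓝 (u z))) ∧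
        (∀ z : ZN N, Tendsto (fun k => a (z + y (φ k))) atTop (𝓝 (atil z))) ∧
        (∃ C : ℝ≥0∞, C ≠ ⊤ ∧ ∀ k,
          eInt (fun x' y' => |grad (fun z => v (φ k) (z + y (φ k))) x' y'| ^ p) ≤ C ∧
          eInt (fun x' y' =>
            a (x' + y (φ k)) * |grad (fun z => v (φ k) (z + y (φ k))) x' y'| ^ q) ≤ C) ∧
        eInt (fun x' y' => |grad u x' y'| ^ q) < ⊤ ∧
        Tendsto (fun k =>
            eInt (fun x' y' =>
              |a (x' + y (φ k)) ^ (1 / q) * grad u x' y' -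
                atil x' ^ (1 / q) * grad u x' y'| ^ q)) atTop (𝓝 0) ∧
        Filter.limsup (fun k =>
            eInt (fun x' y' =>
              a (x' + y (φ k)) *
                |grad (fun z => v (φ k) (z + y (φ k)) - u z) x' y'| ^ q)) atTop ≤
          Filter.liminf (fun k =>
            eInt (fun x' y' =>
              |a (x' + y (φ k)) ^ (1 / q) * grad (fun z => v (φ k) (z + y (φ k))) x' y' -
                atil x' ^ (1 / q) * grad u x' y'| ^ q)) atTop := by
  obtain ⟨A, hA⟩ := habd
  have hp0 : 0 < p := by linarith
  have hq1 : 1 ≤ q := by linarith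
  have hq0 : 0 < q := by linarith
  have hr0 : 0 < r := by
    refine lt_of_le_of_lt ?_ hr
    rw [hpstar]
    have : 0 < (N : ℝ) - p := by linarith
    positivity
  set S := sInf { c : ℝ≥0∞ | ∃ u : ZN N → ℝ, (Function.support u).Finite ∧
    vsum r u = 1 ∧ energy p q a u = c }
  have hS : S < ⊤ := lt_of_le_of_lt (sInf_le ⟨v 0, hvfin 0, hvr 0, rfl⟩)
    (energy_lt_top hp0 hq0 a (hvfin 0))
  obtain ⟨n₀, hn₀⟩ := eventually_atTop.1 (hvmin.eventually_lt_const
    (ENNReal.lt_add_right hS.ne one_ne_zero))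
  have hvb (n : ℕ) (x : ZN N) : v n x ∈ Set.Icc (-1 : ℝ) 1 :=
    abs_le.1 (abs_le_one_of_vsum_eq_one hr0 (hvr n) x)
  obtain ⟨φ₁, hφ₁, u, hub, hu⟩ := exists_subseq_tendsto_of_bounded
    (f := fun n z => v (n + n₀) (z + y (n + n₀))) fun n z => hvb _ _
  obtain ⟨φ₂, hφ₂, atil, hab, hatil⟩ := exists_subseq_tendsto_of_bounded
    (f := fun n z => a (z + y (φ₁ n + n₀))) fun n z => ⟨ha _, hA _⟩
  obtain ⟨L, -, φ₃, hφ₃, hL⟩ := isCompact_univ.tendsto_subseq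
    (x := fun n => eInt (fun x' y' =>
      |a (x' + y (φ₁ (φ₂ n) + n₀)) ^ (1 / q) *
          grad (fun z => v (φ₁ (φ₂ n) + n₀) (z + y (φ₁ (φ₂ n) + n₀))) x' y' -
        atil x' ^ (1 / q) * grad u x' y'| ^ q)) fun n => Set.mem_univ _
  set φ : ℕ → ℕ := fun k => φ₁ (φ₂ (φ₃ k)) + n₀
  have hu' (z : ZN N) : Tendsto (fun k => v (φ k) (z + y (φ k))) atTop (𝓝 (u z)) :=
    (hu z).comp (hφ₂.comp hφ₃).tendsto_atTop
  have hatil' (z : ZN N) : Tendsto (fun k => a (z + y (φ k))) atTop (𝓝 (atil z)) :=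
    (hatil z).comp hφ₃.tendsto_atTop
  have hE (k : ℕ) : energy p q (fun x => a (x + y (φ k))) (fun x => v (φ k) (x + y (φ k))) ≤
      S + 1 := by
    rw [energy_translate]
    exact (hn₀ _ (Nat.le_add_left _ _)).le
  have hS1 : S + 1 ≠ ⊤ := ENNReal.add_ne_top.2 ⟨hS.ne, ENNReal.one_ne_top⟩
  have hgp (k : ℕ) : eInt (fun x' y' => |grad (fun z => v (φ k) (z + y (φ k))) x' y'| ^ p) ≤
      ENNReal.ofReal p * (S + 1) :=
    (eInt_rpow_grad_le_energy hp0 hq0 (fun x => ha (x + y (φ k))) _).trans (by gcongr; exact hE k)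
  have hup : eInt (fun x' y' => |grad u x' y'| ^ p) ≤ ENNReal.ofReal p * (S + 1) :=
    eInt_le_of_tendsto (fun x' y' => (((hu' y').sub (hu' x')).abs).rpow_const (Or.inr hp0.le)) hgp
  have huq : eInt (fun x' y' => |grad u x' y'| ^ q) < ⊤ := by
    have h : eInt (fun x' y' => |grad u x' y'| ^ q) ≤
        eInt (fun x' y' => 2 ^ (q - p) * |grad u x' y'| ^ p) := by
      refine eInt_mono fun x' y' => ?_
      have h2 : |grad u x' y'| ≤ 2 := by
        have h1 := hub x'
        have h2 := hub y'
        exact abs_le.2 ⟨by unfold grad; linarith [h1.2, h2.1], by unfold grad; linarith [h1.1, h2.2]⟩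
      calc |grad u x' y'| ^ q = |grad u x' y'| ^ (q - p) * |grad u x' y'| ^ p := by
            rw [← Real.rpow_add_of_nonneg (abs_nonneg _) (by linarith) hp0.le, sub_add_cancel]
        _ ≤ _ := by gcongr
    refine h.trans_lt ?_
    rw [eInt_const_mul _ (by positivity)]
    exact ENNReal.mul_lt_top ENNReal.ofReal_lt_top
      (hup.trans_lt (ENNReal.mul_lt_top ENNReal.ofReal_lt_top hS1.lt_top))
  have hG : Tendsto (fun k => eInt (fun x' y' =>
      |a (x' + y (φ k)) ^ (1 / q) * grad u x' y' - atil x' ^ (1 / q) * grad u x' y'| ^ q))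
      atTop (𝓝 0) := by
    have hA0 : 0 ≤ A := (ha 0).trans (hA 0)
    have h0 : eInt (fun _ _ : ZN N => (0 : ℝ)) = 0 := by simp [eInt]
    rw [← h0]
    refine tendsto_eInt_of_dominated (B := fun x' y' => A * |grad u x' y'| ^ q) ?_ ?_ ?_
    · rw [eInt_const_mul _ hA0]
      exact ENNReal.mul_ne_top ENNReal.ofReal_ne_top huq.ne
    · intro k x' y'
      rw [← sub_mul, abs_mul, Real.mul_rpow (abs_nonneg _) (abs_nonneg _)]
      gcongr
      exact abs_rpow_inv_sub_rpow_inv_rpow_le hq0 (ha _) (hab x').1 (hA _) (hab x').2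
    · intro x' y'
      have h1 : Tendsto (fun k => a (x' + y (φ k)) ^ (1 / q)) atTop (𝓝 (atil x' ^ (1 / q))) :=
        (hatil' x').rpow_const (Or.inr (by positivity))
      have h2 := ((((h1.mul_const (grad u x' y')).sub_const
        (atil x' ^ (1 / q) * grad u x' y')).abs).rpow_const (p := q) (Or.inr hq0.le))
      simpa [Real.zero_rpow hq0.ne'] using h2
  refine ⟨φ, fun i j hij => Nat.add_lt_add_right (hφ₁ (hφ₂ (hφ₃ hij))) n₀, u, atil,
    fun z => (hab z).1, hu', hatil', ⟨ENNReal.ofReal q * (S + 1), ?_, fun k => ⟨?_, ?_⟩⟩,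
    huq, hG, ?_⟩
  · exact ENNReal.mul_ne_top ENNReal.ofReal_ne_top hS1
  · exact (hgp k).trans (by gcongr)
  · exact (eInt_weighted_rpow_grad_le_energy hp0 hq0 (fun x => a (x + y (φ k))) _).trans
      (by gcongr; exact hE k)
  · have hLk : Tendsto (fun k => eInt (fun x' y' =>
        |a (x' + y (φ k)) ^ (1 / q) * grad (fun z => v (φ k) (z + y (φ k))) x' y' -
          atil x' ^ (1 / q) * grad u x' y'| ^ q)) atTop (𝓝 L) := hL
    rw [hLk.liminf_eq]
    have hlim := (((hLk.ennrpow_const (1 / q)).add (hG.ennrpow_const (1 / q))).ennrpow_const q)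
    rw [ENNReal.zero_rpow_of_pos (by positivity), add_zero, ← ENNReal.rpow_mul,
      one_div_mul_cancel hq0.ne', ENNReal.rpow_one] at hlim
    rw [← hlim.limsup_eq]
    refine limsup_le_limsup (Eventually.of_forall fun k => ?_)
    have hsymm : eInt (fun x' y' => |a (x' + y (φ k)) ^ (1 / q) * grad u x' y' -
          atil x' ^ (1 / q) * grad u x' y'| ^ q) =
        eInt (fun x' y' => |atil x' ^ (1 / q) * grad u x' y' -
          a (x' + y (φ k)) ^ (1 / q) * grad u x' y'| ^ q) := by
      simp only [abs_sub_comm]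
    beta_reduce
    rw [hsymm]
    refine le_trans (eInt_mono fun x' y' => le_of_eq ?_) (eInt_rpow_abs_add_le hq1 _ _)
    have ha0 := ha (x' + y (φ k))
    rw [sub_add_sub_cancel, ← mul_sub, abs_mul, Real.mul_rpow (abs_nonneg _) (abs_nonneg _),
      abs_of_nonneg (Real.rpow_nonneg ha0 _), ← Real.rpow_mul ha0, one_div_mul_cancel hq0.ne',
      Real.rpow_one]
    congr 3
    simp only [grad]
    ring
end
end
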